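/- arXiv:1204.0276 — 2 statements merged into one kernel-verified Lean document; each statement's English description precedes it below -/
import Mathlib

section
/- Let (W,S) be the Coxeter system of type A₂, i.e. S = {s₁, s₂} with s₁² = s₂² = (s₁s₂)³ = e, and let * = id, so that I_* = {e, s₁, s₂, s₁s₂s₁}. Then there exists a unique K-linear bijection η : 𝕄 → M such that η(X_∅) = a_e and η(ρ_s(v)) = T_s(η(v)) for all s ∈ S and v ∈ 𝕄. -/
open Finsupp

noncomputable section

/-- `K = ℚ(u)`, the field of rational functions in `u` over `ℚ`. -/
abbrev K : Type := RatFunc ℚ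

/-- The indeterminate `u`. -/
noncomputable def u : K := RatFunc.X

variable {B W : Type*} [Group W] {Mat : CoxeterMatrix B}

/-- `ρ_s : V → V`, left multiplication by the standard generator `T_s` of the
Iwahori–Hecke algebra of `W` in its standard basis `(δ_x)_{x ∈ W}`:
`ρ_s δ_x = δ_{sx}` if `l(sx) > l(x)`, and
`ρ_s δ_x = (u²−1) δ_x + u² δ_{sx}` if `l(sx) < l(x)`. -/
noncomputable def rho (cs : CoxeterSystem Mat W) (s : W) : (W →₀ K) →ₗ[K] (W →₀ K) :=
  Finsupp.lsum K fun x => LinearMap.toSpanSingleton K (W →₀ K)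
    (if cs.length (s * x) > cs.length x then Finsupp.single (s * x) 1
     else (u ^ 2 - 1) • Finsupp.single x (1 : K) + (u ^ 2 : K) • Finsupp.single (s * x) 1)

/-- `X_∅ = Σ_{x ∈ W, x* = x} u^{−l(x)} δ_x`. -/
noncomputable def Xempty [Fintype W] [DecidableEq W] (cs : CoxeterSystem Mat W)
    (star : W ≃* W) : W →₀ K :=
  ∑ x : W, if star x = x then (u ^ (-(cs.length x : ℤ))) • Finsupp.single x (1 : K) else 0

/-- `𝕄`, the smallest `K`-subspace of `V` containing `X_∅` and stable under `ρ_s`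
for all `s ∈ S`. -/
noncomputable def MM [Fintype W] [DecidableEq W] (cs : CoxeterSystem Mat W)
    (star : W ≃* W) : Submodule K (W →₀ K) :=
  sInf {p : Submodule K (W →₀ K) | Xempty cs star ∈ p ∧
    ∀ (i : B) (v : W →₀ K), v ∈ p → rho cs (cs.simple i) v ∈ p}

theorem Xempty_mem_MM [Fintype W] [DecidableEq W] (cs : CoxeterSystem Mat W)
    (star : W ≃* W) : Xempty cs star ∈ MM cs star :=
  Submodule.mem_sInf.2 fun _ hp => hp.1

theorem rho_mem_MM [Fintype W] [DecidableEq W] (cs : CoxeterSystem Mat W) (star : W ≃* W)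
    (i : B) (v : W →₀ K) (hv : v ∈ MM cs star) : rho cs (cs.simple i) v ∈ MM cs star :=
  Submodule.mem_sInf.2 fun p hp => hp.2 i v (Submodule.mem_sInf.1 hv p hp)

/-- `I_* = {w ∈ W : w* = w⁻¹}`. -/
def Istar (star : W ≃* W) : Set W := {w : W | star w = w⁻¹}

theorem one_mem_Istar (star : W ≃* W) : (1 : W) ∈ Istar star := by
  simp [Istar]

/-- `M`, the free `K`-module with basis `(a_w)_{w ∈ I_*}`; the basis element `a_w` is
`Finsupp.single w 1`. -/
abbrev InvolM (star : W ≃* W) : Type _ := ↥(Istar star) →₀ K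

/-- The assertion that the `K`-linear map `T : M → M` is the map `T_s` (for `s` the simple
reflection of index `i`) defined by:
`T_s a_w = u a_w + (u+1) a_{sw}` if `sw = w s*` and `l(sw) > l(w)`;
`T_s a_w = (u²−u−1) a_w + (u²−u) a_{sw}` if `sw = w s*` and `l(sw) < l(w)`;
`T_s a_w = a_{s w s*}` if `sw ≠ w s*` and `l(sw) > l(w)`;
`T_s a_w = (u²−1) a_w + u² a_{s w s*}` if `sw ≠ w s*` and `l(sw) < l(w)`. -/
def IsTs (cs : CoxeterSystem Mat W) (star : W ≃* W) (i : B)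
    (T : InvolM star →ₗ[K] InvolM star) : Prop :=
  ∀ w : ↥(Istar star),
    (∀ w' : ↥(Istar star), (w' : W) = cs.simple i * (w : W) →
      cs.simple i * (w : W) = (w : W) * star (cs.simple i) →
      (cs.length (cs.simple i * (w : W)) > cs.length (w : W) →
        T (single w 1) = u • single w 1 + (u + 1) • single w' 1) ∧
      (cs.length (cs.simple i * (w : W)) < cs.length (w : W) →
        T (single w 1) = (u ^ 2 - u - 1) • single w 1 + (u ^ 2 - u) • single w' 1)) ∧
    (∀ w' : ↥(Istar star), (w' : W) = cs.simple i * (w : W) * star (cs.simple i) →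
      cs.simple i * (w : W) ≠ (w : W) * star (cs.simple i) →
      (cs.length (cs.simple i * (w : W)) > cs.length (w : W) →
        T (single w 1) = single w' 1) ∧
      (cs.length (cs.simple i * (w : W)) < cs.length (w : W) →
        T (single w 1) = (u ^ 2 - 1) • single w 1 + (u ^ 2 : K) • single w' 1))

/-- The defining property of `η : 𝕄 → M`: `η` is a `K`-linear bijection with
`η(X_∅) = a_e` and `η(ρ_s(v)) = T_s(η(v))` for all `s ∈ S` and `v ∈ 𝕄`. -/
def IsEta [Fintype W] [DecidableEq W] (cs : CoxeterSystem Mat W) (star : W ≃* W)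
    (Ts : B → InvolM star →ₗ[K] InvolM star)
    (η : ↥(MM cs star) →ₗ[K] InvolM star) : Prop :=
  Function.Bijective η ∧
  η ⟨Xempty cs star, Xempty_mem_MM cs star⟩ = single ⟨1, one_mem_Istar star⟩ 1 ∧
  ∀ (i : B) (v : ↥(MM cs star)),
    η ⟨rho cs (cs.simple i) (v : W →₀ K), rho_mem_MM cs star i (v : W →₀ K) v.2⟩
      = Ts i (η v)


theorem rho_single_of_lt (cs : CoxeterSystem Mat W) {s x : W}
    (h : cs.length x < cs.length (s * x)) :
    rho cs s (single x 1) = single (s * x) 1 := by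
  simp [rho, h]

theorem rho_single_of_not_lt (cs : CoxeterSystem Mat W) {s x : W}
    (h : ¬ cs.length x < cs.length (s * x)) :
    rho cs s (single x 1) =
      (u ^ 2 - 1) • single x (1 : K) + (u ^ 2 : K) • single (s * x) 1 := by
  simp only [rho, lsum_single, gt_iff_lt, if_neg h, LinearMap.toSpanSingleton_apply, one_smul]

theorem u_ne_zero : u ≠ 0 := RatFunc.X_ne_zero

theorem u_sub_one_ne_zero : u - 1 ≠ 0 := by
  intro h
  have hk : (algebraMap (Polynomial ℚ) K) Polynomial.X = algebraMap (Polynomial ℚ) K 1 := by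
    rw [RatFunc.algebraMap_X, map_one]
    exact sub_eq_zero.1 h
  have h0 := congrArg (Polynomial.eval 0) (RatFunc.algebraMap_injective ℚ hk)
  simp at h0

theorem u_add_one_ne_zero : u + 1 ≠ 0 := by
  intro h
  have hk : (algebraMap (Polynomial ℚ) K) (Polynomial.X + Polynomial.C 1) =
      algebraMap (Polynomial ℚ) K 0 := by
    rw [map_add, RatFunc.algebraMap_X, Polynomial.C_1, map_one, map_zero]
    exact h
  exact Polynomial.X_add_C_ne_zero 1 (RatFunc.algebraMap_injective ℚ hk)

/-- An injective intertwiner `φ : M → V` with image in `𝕄` that sends `a_e` to `X_∅` has an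
inverse `𝕄 → M`, which is the unique `η`. -/
theorem existsUnique_isEta_of_intertwiner [Fintype W] [DecidableEq W] (cs : CoxeterSystem Mat W)
    (star : W ≃* W) (Ts : B → InvolM star →ₗ[K] InvolM star)
    (φ : InvolM star →ₗ[K] (W →₀ K)) (hinj : Function.Injective φ)
    (hone : φ (single ⟨1, one_mem_Istar star⟩ 1) = Xempty cs star)
    (hcomm : ∀ i m, φ (Ts i m) = rho cs (cs.simple i) (φ m))
    (hmem : ∀ m, φ m ∈ MM cs star) :
    ∃! η : ↥(MM cs star) →ₗ[K] InvolM star, IsEta cs star Ts η := by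
  have hle : MM cs star ≤ LinearMap.range φ := by
    refine sInf_le ⟨⟨_, hone⟩, ?_⟩
    rintro i _ ⟨m, rfl⟩
    exact ⟨Ts i m, hcomm i m⟩
  let ψ : InvolM star →ₗ[K] ↥(MM cs star) := φ.codRestrict _ hmem
  have hψ : Function.Bijective ψ := by
    refine ⟨fun a b hab => hinj (congrArg Subtype.val hab), fun v => ?_⟩
    obtain ⟨m, hm⟩ := hle v.2
    exact ⟨m, Subtype.ext hm⟩
  let e := LinearEquiv.ofBijective ψ hψ
  have hstep (i : B) (v : ↥(MM cs star)) :
      e.symm ⟨rho cs (cs.simple i) v, rho_mem_MM cs star i v v.2⟩ = Ts i (e.symm v) := by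
    refine e.symm_apply_eq.2 (Subtype.ext ?_)
    obtain ⟨m, rfl⟩ := e.surjective v
    rw [e.symm_apply_apply]
    exact (hcomm i m).symm
  refine ⟨e.symm.toLinearMap, ⟨e.symm.bijective, ?_, fun i v => ?_⟩, ?_⟩
  · refine e.symm_apply_eq.2 (Subtype.ext ?_)
    exact hone.symm
  · exact hstep i v
  · rintro η ⟨-, h1, h2⟩
    have key : MM cs star ≤
        (LinearMap.eqLocus η e.symm.toLinearMap).map (MM cs star).subtype := by
      refine sInf_le ⟨⟨⟨_, Xempty_mem_MM cs star⟩, ?_, rfl⟩, ?_⟩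
      · refine h1.trans (e.symm_apply_eq.2 (Subtype.ext ?_)).symm
        exact hone.symm
      · rintro i _ ⟨v, hv, rfl⟩
        refine ⟨⟨_, rho_mem_MM cs star i v v.2⟩, ?_, rfl⟩
        have hv' : η v = e.symm v := hv
        refine (h2 i v).trans ?_
        rw [hv']
        exact (hstep i v).symm
    ext1 v
    obtain ⟨w, hw, hwv⟩ := key v.2
    obtain rfl : w = v := Subtype.ext hwv
    exact hw

/-- The action of a simple reflection `s` on the vectors `φ(a_w)`, in terms of its action `R` on
the standard basis `δ₁, δ_s, δ_t, δ_st, δ_ts, δ_sts`. -/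
theorem intertwining_A₂ {F V : Type*} [Field F] [AddCommGroup V] [Module F V] {q : F}
    (hq : q ≠ 0) (R : V →ₗ[F] V) {d ds dt dst dts dsts : V}
    (h1 : R d = ds) (h2 : R dt = dst) (h3 : R dts = dsts)
    (h4 : R ds = (q ^ 2 - 1) • ds + q ^ 2 • d)
    (h5 : R dst = (q ^ 2 - 1) • dst + q ^ 2 • dt)
    (h6 : R dsts = (q ^ 2 - 1) • dsts + q ^ 2 • dts) :
    let X := d + q⁻¹ • (ds + dt) + (q ^ 2)⁻¹ • (dst + dts) + (q ^ 3)⁻¹ • dsts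
    let A := ((q - 1) / q) • (ds + q⁻¹ • dst + (q ^ 2)⁻¹ • dsts)
    let A' := ((q - 1) / q) • (dt + q⁻¹ • dts + (q ^ 2)⁻¹ • dsts)
    let L := ((q - 1) / q) • (dst + dts + (1 + q⁻¹ - (q ^ 2)⁻¹) • dsts)
    R X = q • X + (q + 1) • A ∧
      R A = (q ^ 2 - q - 1) • A + (q ^ 2 - q) • X ∧
      R A' = L ∧
      R L = (q ^ 2 - 1) • L + q ^ 2 • A' := by
  refine ⟨?_, ?_, ?_, ?_⟩ <;>
  · simp only [map_add, map_smul, h1, h2, h3, h4, h5, h6]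
    match_scalars <;> field_simp <;> ring

section A₂

variable (cs : CoxeterSystem (CoxeterMatrix.Aₙ 2) W)

local notation "s₁" => cs.simple 0
local notation "s₂" => cs.simple 1

theorem braid_A₂ : s₂ * (s₁ * s₂) = s₁ * (s₂ * s₁) := by
  have h : (s₁ * s₂) ^ 3 = 1 := cs.simple_mul_simple_pow 0 1
  have hk : (s₁ * (s₂ * s₁)) * (s₂ * (s₁ * s₂)) = 1 := by
    simpa only [pow_succ, pow_zero, one_mul, mul_assoc] using h
  rw [eq_inv_of_mul_eq_one_right hk]
  simp [mul_assoc]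

theorem braid_A₂_left : s₂ * (s₁ * (s₂ * s₁)) = s₁ * s₂ := by
  rw [← braid_A₂ cs]
  simp

theorem braid_A₂_right : s₁ * (s₂ * (s₁ * s₂)) = s₂ * s₁ := by
  rw [braid_A₂ cs]
  simp

/-- The homomorphism from a Coxeter group of type `A₂` to the symmetric group on three letters. -/
def permHom : W →* Equiv.Perm (Fin 3) :=
  cs.lift ⟨![Equiv.swap 0 1, Equiv.swap 1 2], by
    unfold CoxeterMatrix.IsLiftable
    decide⟩

theorem permHom_simple_zero : permHom cs s₁ = Equiv.swap 0 1 :=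
  cs.lift_apply_simple _ 0

theorem permHom_simple_one : permHom cs s₂ = Equiv.swap 1 2 :=
  cs.lift_apply_simple _ 1

theorem ne_of_permHom_ne {x y : W} (h : permHom cs x ≠ permHom cs y) : x ≠ y :=
  fun hxy => h (congrArg _ hxy)

theorem pairwise_ne_A₂ :
    [1, s₁, s₂, s₁ * s₂, s₂ * s₁, s₁ * (s₂ * s₁)].Pairwise (· ≠ ·) := by
  have h : ([1, s₁, s₂, s₁ * s₂, s₂ * s₁, s₁ * (s₂ * s₁)].map (permHom cs)).Pairwise (· ≠ ·) := by
    simp only [List.map_cons, List.map_nil, map_mul, map_one, permHom_simple_zero,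
      permHom_simple_one]
    decide
  exact (List.pairwise_map.1 h).imp (ne_of_permHom_ne cs)

theorem eq_of_A₂ (w : W) :
    w = 1 ∨ w = s₁ ∨ w = s₂ ∨ w = s₁ * s₂ ∨ w = s₂ * s₁ ∨ w = s₁ * (s₂ * s₁) := by
  induction w using cs.simple_induction_left with
  | one => simp
  | mul_simple_left w i ih =>
    fin_cases i <;> rcases ih with rfl | rfl | rfl | rfl | rfl | rfl <;>
      simp [braid_A₂, braid_A₂_left]

theorem length_simple_mul_simple_A₂ {i j : Fin 2} (h : cs.simple i ≠ cs.simple j) :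
    cs.length (cs.simple i * cs.simple j) = 2 := by
  have h1 := cs.length_simple_mul (cs.simple j) i
  rw [cs.length_simple] at h1
  rcases h1 with h1 | h1
  · exact h1
  · have h2 : cs.simple i * cs.simple j = 1 := cs.length_eq_zero_iff.1 (by omega)
    exact absurd ((mul_eq_one_iff_eq_inv.1 h2).trans (cs.inv_simple j)) h

theorem lengths_A₂ :
    cs.length (s₁ * s₂) = 2 ∧ cs.length (s₂ * s₁) = 2 ∧ cs.length (s₁ * (s₂ * s₁)) = 3 := by
  have hp := pairwise_ne_A₂ cs
  simp only [List.pairwise_cons, List.mem_cons, List.not_mem_nil, or_false, forall_eq_or_imp,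
    forall_eq] at hp
  have h12 := length_simple_mul_simple_A₂ cs hp.2.1.1
  have h21 := length_simple_mul_simple_A₂ cs hp.2.1.1.symm
  refine ⟨h12, h21, ?_⟩
  have h1 := cs.length_simple_mul (s₂ * s₁) 0
  rw [h21] at h1
  rcases h1 with h1 | h1
  · exact h1
  · obtain ⟨i, hi⟩ := cs.length_eq_one_iff.1 (show cs.length (s₁ * (s₂ * s₁)) = 1 by omega)
    fin_cases i
    · exact absurd hi.symm hp.2.1.2.2.2
    · exact absurd hi.symm hp.2.2.1.2.2

/-- The matrices of the two generators in the standard basis of `V`. -/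
theorem rho_single_A₂ :
    (rho cs s₁ (single 1 1) = single s₁ 1 ∧
      rho cs s₁ (single s₂ 1) = single (s₁ * s₂) 1 ∧
      rho cs s₁ (single (s₂ * s₁) 1) = single (s₁ * (s₂ * s₁)) 1 ∧
      rho cs s₁ (single s₁ 1) =
        (u ^ 2 - 1) • single s₁ (1 : K) + (u ^ 2 : K) • single 1 1 ∧
      rho cs s₁ (single (s₁ * s₂) 1) =
        (u ^ 2 - 1) • single (s₁ * s₂) (1 : K) + (u ^ 2 : K) • single s₂ 1 ∧
      rho cs s₁ (single (s₁ * (s₂ * s₁)) 1) =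
        (u ^ 2 - 1) • single (s₁ * (s₂ * s₁)) (1 : K) + (u ^ 2 : K) • single (s₂ * s₁) 1) ∧
    (rho cs s₂ (single 1 1) = single s₂ 1 ∧
      rho cs s₂ (single s₁ 1) = single (s₂ * s₁) 1 ∧
      rho cs s₂ (single (s₁ * s₂) 1) = single (s₁ * (s₂ * s₁)) 1 ∧
      rho cs s₂ (single s₂ 1) =
        (u ^ 2 - 1) • single s₂ (1 : K) + (u ^ 2 : K) • single 1 1 ∧
      rho cs s₂ (single (s₂ * s₁) 1) =
        (u ^ 2 - 1) • single (s₂ * s₁) (1 : K) + (u ^ 2 : K) • single s₁ 1 ∧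
      rho cs s₂ (single (s₁ * (s₂ * s₁)) 1) =
        (u ^ 2 - 1) • single (s₁ * (s₂ * s₁)) (1 : K) + (u ^ 2 : K) • single (s₁ * s₂) 1) := by
  obtain ⟨h12, h21, h3⟩ := lengths_A₂ cs
  have hb := braid_A₂ cs
  have hbl := braid_A₂_left cs
  refine ⟨⟨?_, ?_, ?_, ?_, ?_, ?_⟩, ?_, ?_, ?_, ?_, ?_, ?_⟩
  all_goals first
    | rw [rho_single_of_lt] <;> simp [h12, h21, h3, hb, hbl]; done
    | rw [rho_single_of_not_lt] <;> simp [h12, h21, h3, hbl]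

theorem Xempty_A₂ [Fintype W] [DecidableEq W] :
    Xempty cs (MulEquiv.refl W) = single 1 1 + u⁻¹ • (single s₁ 1 + single s₂ 1) +
      (u ^ 2)⁻¹ • (single (s₁ * s₂) 1 + single (s₂ * s₁) 1) +
      (u ^ 3)⁻¹ • single (s₁ * (s₂ * s₁)) (1 : K) := by
  obtain ⟨h12, h21, h3⟩ := lengths_A₂ cs
  have hp := pairwise_ne_A₂ cs
  have huniv : (Finset.univ : Finset W) =
      [1, s₁, s₂, s₁ * s₂, s₂ * s₁, s₁ * (s₂ * s₁)].toFinset := by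
    ext w
    simpa using eq_of_A₂ cs w
  rw [Xempty, huniv, List.sum_toFinset _ hp]
  simp only [MulEquiv.refl_apply, if_true, List.map_cons, List.map_nil, List.sum_cons,
    List.sum_nil, cs.length_one, cs.length_simple, h12, h21, h3, zpow_neg, zpow_natCast,
    pow_zero, pow_one, inv_one, one_smul, smul_add]
  abel

/-- The family `w ↦ φ(a_w)` of vectors of `V` defining the inverse of `η`. -/
def involVec [Fintype W] [DecidableEq W] (w : W) : W →₀ K :=
  if w = 1 then Xempty cs (MulEquiv.refl W)
  else if w = s₁ then ((u - 1) / u) •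
    (single s₁ 1 + u⁻¹ • single (s₁ * s₂) 1 + (u ^ 2)⁻¹ • single (s₁ * (s₂ * s₁)) 1)
  else if w = s₂ then ((u - 1) / u) •
    (single s₂ 1 + u⁻¹ • single (s₂ * s₁) 1 + (u ^ 2)⁻¹ • single (s₁ * (s₂ * s₁)) 1)
  else ((u - 1) / u) • (single (s₁ * s₂) 1 + single (s₂ * s₁) 1 +
    (1 + u⁻¹ - (u ^ 2)⁻¹) • single (s₁ * (s₂ * s₁)) 1)

theorem involVec_A₂ [Fintype W] [DecidableEq W] :
    involVec cs 1 = Xempty cs (MulEquiv.refl W) ∧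
    involVec cs s₁ = ((u - 1) / u) •
      (single s₁ 1 + u⁻¹ • single (s₁ * s₂) 1 + (u ^ 2)⁻¹ • single (s₁ * (s₂ * s₁)) 1) ∧
    involVec cs s₂ = ((u - 1) / u) •
      (single s₂ 1 + u⁻¹ • single (s₂ * s₁) 1 + (u ^ 2)⁻¹ • single (s₁ * (s₂ * s₁)) 1) ∧
    involVec cs (s₁ * (s₂ * s₁)) = ((u - 1) / u) • (single (s₁ * s₂) 1 + single (s₂ * s₁) 1 +
      (1 + u⁻¹ - (u ^ 2)⁻¹) • single (s₁ * (s₂ * s₁)) 1) := by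
  have hp := pairwise_ne_A₂ cs
  simp only [List.pairwise_cons, List.mem_cons, List.not_mem_nil, or_false, forall_eq_or_imp,
    forall_eq] at hp
  obtain ⟨⟨h1, h2, -, -, h3⟩, ⟨h4, -, -, h5⟩, ⟨-, -, h6⟩, -⟩ := hp
  refine ⟨?_, ?_, ?_, ?_⟩
  · rw [involVec, if_pos rfl]
  · rw [involVec, if_neg h1.symm, if_pos rfl]
  · rw [involVec, if_neg h2.symm, if_neg h4.symm, if_pos rfl]
  · rw [involVec, if_neg h3.symm, if_neg h5.symm, if_neg h6.symm]

theorem rho_involVec_A₂ [Fintype W] [DecidableEq W] :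
    (rho cs s₁ (involVec cs 1) = u • involVec cs 1 + (u + 1) • involVec cs s₁ ∧
      rho cs s₁ (involVec cs s₁) =
        (u ^ 2 - u - 1) • involVec cs s₁ + (u ^ 2 - u) • involVec cs 1 ∧
      rho cs s₁ (involVec cs s₂) = involVec cs (s₁ * (s₂ * s₁)) ∧
      rho cs s₁ (involVec cs (s₁ * (s₂ * s₁))) =
        (u ^ 2 - 1) • involVec cs (s₁ * (s₂ * s₁)) + (u ^ 2) • involVec cs s₂) ∧
    (rho cs s₂ (involVec cs 1) = u • involVec cs 1 + (u + 1) • involVec cs s₂ ∧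
      rho cs s₂ (involVec cs s₁) = involVec cs (s₁ * (s₂ * s₁)) ∧
      rho cs s₂ (involVec cs s₂) =
        (u ^ 2 - u - 1) • involVec cs s₂ + (u ^ 2 - u) • involVec cs 1 ∧
      rho cs s₂ (involVec cs (s₁ * (s₂ * s₁))) =
        (u ^ 2 - 1) • involVec cs (s₁ * (s₂ * s₁)) + (u ^ 2) • involVec cs s₁) := by
  obtain ⟨hX, hA, hB, hL⟩ := involVec_A₂ cs
  obtain ⟨⟨r1, r2, r3, r4, r5, r6⟩, q1, q2, q3, q4, q5, q6⟩ := rho_single_A₂ cs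
  rw [hX, hA, hB, hL, Xempty_A₂ cs]
  refine ⟨intertwining_A₂ u_ne_zero _ r1 r2 r3 r4 r5 r6, ?_⟩
  obtain ⟨p1, p2, p3, p4⟩ := intertwining_A₂ u_ne_zero _ q1 q2 q3 q4 q5 q6
  rw [add_comm (single s₁ (1 : K)), add_comm (single (s₁ * s₂) (1 : K))]
  exact ⟨p1, p3, p2, p4⟩

/-- The linear map `M → V` that sends `a_w` to `involVec w`. -/
def involMap [Fintype W] [DecidableEq W] : InvolM (MulEquiv.refl W) →ₗ[K] (W →₀ K) :=
  Finsupp.linearCombination K fun w => involVec cs w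

theorem involMap_single [Fintype W] [DecidableEq W] (w : ↥(Istar (MulEquiv.refl W))) (c : K) :
    involMap cs (single w c) = c • involVec cs w :=
  Finsupp.linearCombination_single K c w

theorem mem_Istar_A₂ {w : W} :
    w ∈ Istar (MulEquiv.refl W) ↔ w = 1 ∨ w = s₁ ∨ w = s₂ ∨ w = s₁ * (s₂ * s₁) := by
  have hp := pairwise_ne_A₂ cs
  simp only [List.pairwise_cons, List.mem_cons, List.not_mem_nil, or_false, forall_eq_or_imp,
    forall_eq] at hp
  obtain ⟨-, -, -, ⟨h, -⟩, -⟩ := hp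
  constructor
  · intro hw
    rcases eq_of_A₂ cs w with hk | hk | hk | hk | hk | hk <;> simp only [hk, true_or, or_true]
    · subst hk
      exact absurd (by simpa [Istar] using hw) h
    · subst hk
      exact absurd (by simpa [Istar] using hw.symm) h
  · rintro (rfl | rfl | rfl | rfl) <;> simp [Istar, mul_assoc]

theorem involMap_injective [Fintype W] [DecidableEq W] : Function.Injective (involMap cs) := by
  have hp := pairwise_ne_A₂ cs
  simp only [List.pairwise_cons, List.mem_cons, List.not_mem_nil, or_false, forall_eq_or_imp,
    forall_eq] at hp
  obtain ⟨⟨h1, h2, h3, h4, h5⟩, ⟨h6, h7, h8, h9⟩, ⟨h10, h11, h12⟩, ⟨h13, h14⟩, -⟩ := hp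
  obtain ⟨hX, hA, hB, hL⟩ := involVec_A₂ cs
  have hc : (u - 1) / u ≠ 0 := div_ne_zero u_sub_one_ne_zero u_ne_zero
  have m1 := one_mem_Istar (MulEquiv.refl W)
  have ms : s₁ ∈ Istar (MulEquiv.refl W) := (mem_Istar_A₂ cs).2 (by simp)
  have mt : s₂ ∈ Istar (MulEquiv.refl W) := (mem_Istar_A₂ cs).2 (by simp)
  have ml : s₁ * (s₂ * s₁) ∈ Istar (MulEquiv.refl W) := (mem_Istar_A₂ cs).2 (by simp)
  rw [injective_iff_map_eq_zero]
  intro m hm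
  obtain ⟨a, b, c, d, rfl⟩ : ∃ a b c d : K, m = single ⟨_, m1⟩ a + single ⟨_, ms⟩ b +
      single ⟨_, mt⟩ c + single ⟨_, ml⟩ d := by
    clear hm
    induction m using Finsupp.induction_linear with
    | zero => exact ⟨0, 0, 0, 0, by simp⟩
    | add f g hf hg =>
      obtain ⟨a, b, c, d, rfl⟩ := hf
      obtain ⟨a', b', c', d', rfl⟩ := hg
      refine ⟨a + a', b + b', c + c', d + d', ?_⟩
      simp only [single_add]
      abel
    | single w k =>
      obtain ⟨w, hw⟩ := w
      rcases (mem_Istar_A₂ cs).1 hw with rfl | rfl | rfl | rfl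
      · exact ⟨k, 0, 0, 0, by simp⟩
      · exact ⟨0, k, 0, 0, by simp⟩
      · exact ⟨0, 0, k, 0, by simp⟩
      · exact ⟨0, 0, 0, k, by simp⟩
  simp only [map_add, involMap_single, hX, hA, hB, hL, Xempty_A₂ cs] at hm
  have ha : a = 0 := by
    simpa [single_apply, h1.symm, h2.symm, h3.symm, h4.symm, h5.symm]
      using DFunLike.congr_fun hm 1
  subst ha
  have hb : b = 0 := by
    simpa [single_apply, h1, h6.symm, h7.symm, h8.symm, h9.symm, hc]
      using DFunLike.congr_fun hm s₁
  subst hb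
  have hc' : c = 0 := by
    simpa [single_apply, h2, h6, h10.symm, h11.symm, h12.symm, hc]
      using DFunLike.congr_fun hm s₂
  subst hc'
  have hd : d = 0 := by
    simpa [single_apply, h3, h7, h10, h13.symm, h14.symm, hc]
      using DFunLike.congr_fun hm (s₁ * s₂)
  subst hd
  simp

theorem involVec_mem_MM [Fintype W] [DecidableEq W] {w : W}
    (hw : w ∈ Istar (MulEquiv.refl W)) : involVec cs w ∈ MM cs (MulEquiv.refl W) := by
  obtain ⟨⟨e1, -, -, -⟩, e2, e3, -, -⟩ := rho_involVec_A₂ cs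
  have hX : involVec cs 1 ∈ MM cs (MulEquiv.refl W) := by
    rw [(involVec_A₂ cs).1]
    exact Xempty_mem_MM _ _
  have descend {i : Fin 2} {y : W →₀ K}
      (h : rho cs (cs.simple i) (involVec cs 1) = u • involVec cs 1 + (u + 1) • y) :
      y ∈ MM cs (MulEquiv.refl W) := by
    rw [← Submodule.smul_mem_iff _ u_add_one_ne_zero, ← sub_eq_iff_eq_add'.2 h]
    exact Submodule.sub_mem _ (rho_mem_MM _ _ _ _ hX) (Submodule.smul_mem _ _ hX)
  rcases (mem_Istar_A₂ cs).1 hw with rfl | rfl | rfl | rfl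
  · exact hX
  · exact descend e1
  · exact descend e2
  · rw [← e3]
    exact rho_mem_MM _ _ _ _ (descend e1)

theorem involMap_mem_MM [Fintype W] [DecidableEq W] (m : InvolM (MulEquiv.refl W)) :
    involMap cs m ∈ MM cs (MulEquiv.refl W) :=
  Submodule.sum_mem _ fun w _ => Submodule.smul_mem _ _ (involVec_mem_MM cs w.2)

theorem involMap_comm [Fintype W] [DecidableEq W]
    (Ts : Fin 2 → InvolM (MulEquiv.refl W) →ₗ[K] InvolM (MulEquiv.refl W))
    (hTs : ∀ i, IsTs cs (MulEquiv.refl W) i (Ts i)) (i : Fin 2) (m : InvolM (MulEquiv.refl W)) :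
    involMap cs (Ts i m) = rho cs (cs.simple i) (involMap cs m) := by
  obtain ⟨hl1, hl2, hl3⟩ := lengths_A₂ cs
  obtain ⟨⟨r1, r2, r3, r4⟩, q1, q2, q3, q4⟩ := rho_involVec_A₂ cs
  have hb := braid_A₂ cs
  have hbl := braid_A₂_left cs
  have hbr := braid_A₂_right cs
  have hp := pairwise_ne_A₂ cs
  simp only [List.pairwise_cons, List.mem_cons, List.not_mem_nil, or_false, forall_eq_or_imp,
    forall_eq] at hp
  have hst : s₁ * s₂ ≠ s₂ * s₁ := hp.2.2.2.1.1
  have m1 := one_mem_Istar (MulEquiv.refl W)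
  have ms : s₁ ∈ Istar (MulEquiv.refl W) := (mem_Istar_A₂ cs).2 (by simp)
  have mt : s₂ ∈ Istar (MulEquiv.refl W) := (mem_Istar_A₂ cs).2 (by simp)
  have ml : s₁ * (s₂ * s₁) ∈ Istar (MulEquiv.refl W) := (mem_Istar_A₂ cs).2 (by simp)
  induction m using Finsupp.induction_linear with
  | zero => simp
  | add f g hf hg => simp only [map_add, hf, hg]
  | single w k =>
    suffices h : involMap cs (Ts i (single w 1)) = rho cs (cs.simple i) (involVec cs w) by
      rw [← smul_single_one w k, map_smul, map_smul, map_smul, map_smul, h, involMap_single,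
        one_smul]
    obtain ⟨w, hw⟩ := w
    have hT := hTs i ⟨w, hw⟩
    rcases (mem_Istar_A₂ cs).1 hw with rfl | rfl | rfl | rfl <;>
      revert i <;> refine Fin.forall_fin_two.2 ⟨fun hT => ?_, fun hT => ?_⟩
    · rw [(hT.1 ⟨_, ms⟩ (by simp) (by simp)).1 (by simp), r1]
      simp only [map_add, map_smul, involMap_single, one_smul]
    · rw [(hT.1 ⟨_, mt⟩ (by simp) (by simp)).1 (by simp), q1]
      simp only [map_add, map_smul, involMap_single, one_smul]
    · rw [(hT.1 ⟨_, m1⟩ (by simp) (by simp)).2 (by simp), r2]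
      simp only [map_add, map_smul, involMap_single, one_smul]
    · rw [(hT.2 ⟨_, ml⟩ (by simp [mul_assoc, hb]) (by simpa using hst.symm)).1 (by simp [hl2]), q2]
      simp only [involMap_single, one_smul]
    · rw [(hT.2 ⟨_, ml⟩ (by simp [mul_assoc]) (by simpa using hst)).1 (by simp [hl1]), r3]
      simp only [involMap_single, one_smul]
    · rw [(hT.1 ⟨_, m1⟩ (by simp) (by simp)).2 (by simp), q3]
      simp only [map_add, map_smul, involMap_single, one_smul]
    · rw [(hT.2 ⟨_, mt⟩ (by simp [mul_assoc]) (by simpa [mul_assoc] using hst.symm)).2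
        (by simp [hl2, hl3]), r4]
      simp only [map_add, map_smul, involMap_single, one_smul]
    · rw [(hT.2 ⟨_, ms⟩ (by simp [mul_assoc, hbl])
        (by simpa [mul_assoc, hbl, hbr] using hst)).2 (by simp [hbl, hl1, hl3]), q4]
      simp only [map_add, map_smul, involMap_single, one_smul]

end A₂

/-- for the Coxeter system of type `A₂` (matrix `CoxeterMatrix.Aₙ 2`, so
`S = {s₁, s₂}` with `s₁² = s₂² = (s₁s₂)³ = e`) and `* = id` (so that
`I_* = {e, s₁, s₂, s₁s₂s₁}`), there exists a unique `K`-linear bijection `η : 𝕄 → M`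
such that `η(X_∅) = a_e` and `η(ρ_s(v)) = T_s(η(v))` for all `s ∈ S` and `v ∈ 𝕄`. -/
theorem statement9 {W : Type*} [Group W] [Fintype W] [DecidableEq W]
    (cs : CoxeterSystem (CoxeterMatrix.Aₙ 2) W)
    (Ts : Fin 2 → InvolM (MulEquiv.refl W) →ₗ[K] InvolM (MulEquiv.refl W))
    (hTs : ∀ i, IsTs cs (MulEquiv.refl W) i (Ts i)) :
    ∃! η : ↥(MM cs (MulEquiv.refl W)) →ₗ[K] InvolM (MulEquiv.refl W),
      IsEta cs (MulEquiv.refl W) Ts η := by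
  refine existsUnique_isEta_of_intertwiner cs _ Ts (involMap cs) (involMap_injective cs) ?_
    (involMap_comm cs Ts hTs) (involMap_mem_MM cs)
  rw [involMap_single, one_smul]
  exact (involVec_A₂ cs).1

end
end

section
/- Let (W,S) be the Coxeter system of type A₃, i.e. S = {s₁, s₂, s₃} with s_i² = e, (s₁s₂)³ = (s₂s₃)³ = e, (s₁s₃)² = e, and let * be any group automorphism of W with S* = S and *∘* = id. Then there exists a unique K-linear bijection η : 𝕄 → M such that η(X_∅) = a_e and η(ρ_s(v)) = T_s(η(v)) for all s ∈ S and v ∈ 𝕄. -/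
open Finsupp

noncomputable section

variable {B W : Type*} [Group W] {Mat : CoxeterMatrix B}

/-- The adjacent transpositions generating `Perm (Fin 4)`. -/
def adjSwap (i : Fin 3) : Equiv.Perm (Fin 4) := Equiv.swap i.castSucc i.succ

/-- The number of inversions of a permutation of `Fin 4`. -/
def invCount (p : Equiv.Perm (Fin 4)) : ℕ :=
  (Finset.univ.filter fun ij : Fin 4 × Fin 4 => ij.1 < ij.2 ∧ p ij.2 < p ij.1).card

/-- Codes for the normal forms of the elements of the Coxeter group of type `A₃`. -/
abbrev NFCode : Type := Fin 2 × Fin 3 × Fin 4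

/-- The reduced word attached to a code. -/
def nfWord (c : NFCode) : List (Fin 3) :=
  [0].take c.1 ++ [1, 0].take c.2.1 ++ [2, 1, 0].take c.2.2

/-- Right multiplication by the generator `0` of a code of rank one. -/
def nfMulOne (a : Fin 2) : Fin 2 := 1 - a

/-- Right multiplication by a generator of a code of rank two. -/
def nfMulTwo (a : Fin 2) (b : Fin 3) (i : Fin 2) : Fin 2 × Fin 3 :=
  match b, i with
  | 0, 0 => (nfMulOne a, 0)
  | 0, 1 => (a, 1)
  | 1, 0 => (a, 2)
  | 1, 1 => (a, 0)
  | 2, 0 => (a, 1)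
  | 2, 1 => (nfMulOne a, 2)

/-- Right multiplication of a code by a generator. -/
def nfMul (x : NFCode) (i : Fin 3) : NFCode :=
  let lower (j : Fin 2) : NFCode :=
    ((nfMulTwo x.1 x.2.1 j).1, (nfMulTwo x.1 x.2.1 j).2, x.2.2)
  match x.2.2, i with
  | 0, 0 => lower 0
  | 0, 1 => lower 1
  | 0, 2 => (x.1, x.2.1, 1)
  | 1, 0 => lower 0
  | 1, 1 => (x.1, x.2.1, 2)
  | 1, 2 => (x.1, x.2.1, 0)
  | 2, 0 => (x.1, x.2.1, 3)
  | 2, 1 => (x.1, x.2.1, 1)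
  | 2, 2 => lower 1
  | 3, 0 => (x.1, x.2.1, 2)
  | 3, 1 => lower 0
  | 3, 2 => lower 1

/-- The braid relations of type `A₃`. -/
structure IsBraidTriple {N : Type*} [Monoid N] (t : Fin 3 → N) : Prop where
  comm : t 2 * t 0 = t 0 * t 2
  braid₁ : t 1 * (t 0 * t 1) = t 0 * (t 1 * t 0)
  braid₂ : t 2 * (t 1 * t 2) = t 1 * (t 2 * t 1)

theorem prod_nfWord_nfMul_of_lt {N : Type*} [Monoid N] {t : Fin 3 → N} (ht : IsBraidTriple t)
    (x : NFCode) (i : Fin 3) (h : (nfWord x).length < (nfWord (nfMul x i)).length) :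
    ((nfWord (nfMul x i)).map t).prod = ((nfWord x).map t).prod * t i := by
  obtain ⟨h1, h2, h3⟩ := ht
  have h1' (z) : t 2 * (t 0 * z) = t 0 * (t 2 * z) := by rw [← mul_assoc, h1, mul_assoc]
  have h2' (z) : t 1 * (t 0 * (t 1 * z)) = t 0 * (t 1 * (t 0 * z)) := by
    simpa [mul_assoc] using congrArg (· * z) h2
  have h3' (z) : t 2 * (t 1 * (t 2 * z)) = t 1 * (t 2 * (t 1 * z)) := by
    simpa [mul_assoc] using congrArg (· * z) h3
  have h4 : t 2 * (t 1 * (t 0 * t 2)) = t 1 * (t 2 * (t 1 * t 0)) := by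
    rw [← h1, h3']
  obtain ⟨a, b, c⟩ := x
  fin_cases a <;> fin_cases b <;> fin_cases c <;> fin_cases i <;>
    first
    | (exfalso; revert h; decide)
    | simp [nfWord, nfMul, nfMulTwo, nfMulOne, mul_assoc, h1, h2, h3, h4, h1', h2']

theorem nfMul_nfMul (x : NFCode) (i : Fin 3) : nfMul (nfMul x i) i = x := by
  revert x i; decide +kernel

theorem length_nfWord_lt_or (x : NFCode) (i : Fin 3) :
    (nfWord x).length < (nfWord (nfMul x i)).length ∨
      (nfWord (nfMul x i)).length < (nfWord x).length := by
  revert x i; decide +kernel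

theorem prod_nfWord_nfMul {N : Type*} [Monoid N] {t : Fin 3 → N} (ht : IsBraidTriple t)
    (hsq : ∀ i, t i * t i = 1) (x : NFCode) (i : Fin 3) :
    ((nfWord (nfMul x i)).map t).prod = ((nfWord x).map t).prod * t i := by
  rcases length_nfWord_lt_or x i with h | h
  · exact prod_nfWord_nfMul_of_lt ht x i h
  · have := prod_nfWord_nfMul_of_lt ht (nfMul x i) i (by rwa [nfMul_nfMul])
    rw [nfMul_nfMul] at this
    rw [this, mul_assoc, hsq, mul_one]

/-- The permutation attached to a code. -/
def nfPerm (x : NFCode) : Equiv.Perm (Fin 4) := ((nfWord x).map adjSwap).prod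

theorem nfPerm_injective : Function.Injective nfPerm := by
  intro x y; revert x y; decide +kernel

theorem invCount_nfPerm (x : NFCode) : invCount (nfPerm x) = (nfWord x).length := by
  revert x; decide +kernel

theorem nfPerm_bijective : Function.Bijective nfPerm :=
  (Fintype.bijective_iff_injective_and_card _).2
    ⟨nfPerm_injective, by simp [Fintype.card_perm, Nat.factorial]⟩

theorem nfPerm_nfMul (x : NFCode) (i : Fin 3) : nfPerm (nfMul x i) = nfPerm x * adjSwap i := by
  revert x i; decide +kernel

theorem invCount_mul_adjSwap_le (p : Equiv.Perm (Fin 4)) (i : Fin 3) :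
    invCount (p * adjSwap i) ≤ invCount p + 1 := by
  obtain ⟨x, rfl⟩ := nfPerm_bijective.2 p
  rw [← nfPerm_nfMul, invCount_nfPerm, invCount_nfPerm]
  revert x i; decide +kernel

section CoxeterA3

variable {W : Type*} [Group W] (cs : CoxeterSystem (CoxeterMatrix.Aₙ 3) W)

theorem isLiftable_iff_A3 {G : Type*} [Monoid G] (f : Fin 3 → G) :
    (CoxeterMatrix.Aₙ 3).IsLiftable f ↔
    ∀ i j : Fin 3, (f i * f j) ^ (if i = j then 1 else
      (if (j : ℕ) + 1 = i ∨ (i : ℕ) + 1 = j then 3 else 2)) = 1 := Iff.rfl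

theorem isBraidTriple_simple : IsBraidTriple cs.simple := by
  have key := (isLiftable_iff_A3 cs.simple).1 cs.simple_mul_simple_pow
  have hinv (i) : (cs.simple i)⁻¹ = cs.simple i := cs.inv_simple i
  refine ⟨?_, ?_, ?_⟩
  · have h := key 2 0
    simp [pow_succ] at h
    have := eq_inv_of_mul_eq_one_left h
    simpa [hinv] using this
  · have h := key 1 0
    simp [pow_succ] at h
    have h' : (cs.simple 1 * (cs.simple 0 * cs.simple 1)) *
      (cs.simple 0 * (cs.simple 1 * cs.simple 0)) = 1 := by simpa [mul_assoc] using h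
    have := eq_inv_of_mul_eq_one_left h'
    simpa [hinv, mul_assoc] using this
  · have h := key 2 1
    simp [pow_succ] at h
    have h' : (cs.simple 2 * (cs.simple 1 * cs.simple 2)) *
      (cs.simple 1 * (cs.simple 2 * cs.simple 1)) = 1 := by simpa [mul_assoc] using h
    have := eq_inv_of_mul_eq_one_left h'
    simpa [hinv, mul_assoc] using this

theorem exists_nfWord (w : W) : ∃ x, cs.wordProd (nfWord x) = w := by
  induction w using cs.simple_induction_right with
  | one => exact ⟨(0, 0, 0), by simp [nfWord]⟩
  | mul_simple_right w i ih =>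
    obtain ⟨x, rfl⟩ := ih
    exact ⟨nfMul x i, prod_nfWord_nfMul (isBraidTriple_simple cs)
      cs.simple_mul_simple_self x i⟩

theorem isLiftable_adjSwap : (CoxeterMatrix.Aₙ 3).IsLiftable adjSwap := by
  rw [isLiftable_iff_A3]; decide +kernel

/-- The homomorphism to `Perm (Fin 4)`. -/
def toPerm : W →* Equiv.Perm (Fin 4) := cs.lift ⟨adjSwap, isLiftable_adjSwap⟩

theorem toPerm_simple (i : Fin 3) : toPerm cs (cs.simple i) = adjSwap i :=
  cs.lift_apply_simple _ i

theorem toPerm_wordProd (ω : List (Fin 3)) :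
    toPerm cs (cs.wordProd ω) = (ω.map adjSwap).prod := by
  rw [CoxeterSystem.wordProd, map_list_prod, List.map_map]
  congr 2; funext i; exact toPerm_simple cs i

theorem toPerm_bijective : Function.Bijective (toPerm cs) := by
  constructor
  · intro v w h
    obtain ⟨x, rfl⟩ := exists_nfWord cs v
    obtain ⟨y, rfl⟩ := exists_nfWord cs w
    rw [toPerm_wordProd, toPerm_wordProd] at h
    rw [nfPerm_injective h]
  · intro p
    obtain ⟨x, rfl⟩ := nfPerm_bijective.2 p
    exact ⟨_, toPerm_wordProd cs _⟩

theorem invCount_toPerm_wordProd_le (ω : List (Fin 3)) :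
    invCount (toPerm cs (cs.wordProd ω)) ≤ ω.length := by
  induction ω using List.reverseRecOn with
  | nil => simp; decide +kernel
  | append_singleton ω i ih =>
    rw [cs.wordProd_append, cs.wordProd_singleton, map_mul, toPerm_simple]
    simpa using (invCount_mul_adjSwap_le _ i).trans (Nat.succ_le_succ ih)

theorem length_eq_invCount (w : W) : cs.length w = invCount (toPerm cs w) := by
  apply le_antisymm
  · obtain ⟨x, rfl⟩ := exists_nfWord cs w
    rw [toPerm_wordProd]
    exact (cs.length_wordProd_le _).trans (invCount_nfPerm x).ge
  · obtain ⟨ω, hω, rfl⟩ := cs.exists_isReduced w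
    rw [hω.eq]
    exact invCount_toPerm_wordProd_le cs ω

end CoxeterA3

/-- How a generator acts on a basis element `a_w`: whether `s w = w s*`, whether `s w` is longer
than `w`, and the index of the other basis element involved. -/
structure InvolStep where
  /-- Whether `s w = w s*`. -/
  commutes : Bool
  /-- Whether `s w` is longer than `w`. -/
  ascends : Bool
  /-- The index of `s w` or `s w s*`. -/
  next : Fin 10

/-- Reduced words of the twisted involutions for the trivial (`false`) and the nontrivial (`true`)
diagram automorphism. -/
def involWord : Bool → Fin 10 → List (Fin 3)
  | false => ![[], [0], [1], [2], [0, 2], [0, 1, 0], [1, 2, 1], [1, 0, 2, 1], [0, 1, 2, 1, 0],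
      [0, 1, 0, 2, 1, 0]]
  | true => ![[], [1], [0, 2], [0, 1, 2], [2, 1, 0], [1, 0, 2, 1], [0, 1, 0, 2, 1],
      [0, 1, 2, 1, 0], [1, 0, 2, 1, 0], [0, 1, 0, 2, 1, 0]]

/-- The action of the generators on the twisted involutions listed by `involWord`. -/
def involStep : Bool → Fin 3 → Fin 10 → InvolStep
  | false => ![
    ![⟨true, true, 1⟩, ⟨true, false, 0⟩, ⟨false, true, 5⟩, ⟨true, true, 4⟩, ⟨true, false, 3⟩,
      ⟨false, false, 2⟩, ⟨false, true, 8⟩, ⟨false, true, 9⟩, ⟨false, false, 6⟩,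
      ⟨false, false, 7⟩],
    ![⟨true, true, 2⟩, ⟨false, true, 5⟩, ⟨true, false, 0⟩, ⟨false, true, 6⟩, ⟨false, true, 7⟩,
      ⟨false, false, 1⟩, ⟨false, false, 3⟩, ⟨false, false, 4⟩, ⟨true, true, 9⟩,
      ⟨true, false, 8⟩],
    ![⟨true, true, 3⟩, ⟨true, true, 4⟩, ⟨false, true, 6⟩, ⟨true, false, 0⟩, ⟨true, false, 1⟩,
      ⟨false, true, 8⟩, ⟨false, false, 2⟩, ⟨false, true, 9⟩, ⟨false, false, 5⟩,
      ⟨false, false, 7⟩]]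
  | true => ![
    ![⟨false, true, 2⟩, ⟨false, true, 3⟩, ⟨false, false, 0⟩, ⟨false, false, 1⟩, ⟨false, true, 7⟩,
      ⟨true, true, 6⟩, ⟨true, false, 5⟩, ⟨false, false, 4⟩, ⟨true, true, 9⟩, ⟨true, false, 8⟩],
    ![⟨true, true, 1⟩, ⟨true, false, 0⟩, ⟨false, true, 5⟩, ⟨false, true, 6⟩, ⟨false, true, 8⟩,
      ⟨false, false, 2⟩, ⟨false, false, 3⟩, ⟨true, true, 9⟩, ⟨false, false, 4⟩,
      ⟨true, false, 7⟩],
    ![⟨false, true, 2⟩, ⟨false, true, 4⟩, ⟨false, false, 0⟩, ⟨false, true, 7⟩, ⟨false, false, 1⟩,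
      ⟨true, true, 8⟩, ⟨true, true, 9⟩, ⟨false, false, 3⟩, ⟨true, false, 5⟩, ⟨true, false, 6⟩]]

theorem next_next (b : Bool) (i : Fin 3) (k : Fin 10) :
    (involStep b i (involStep b i k).next).next = k := by
  revert b i k; decide +kernel

theorem commutes_next (b : Bool) (i : Fin 3) (k : Fin 10) :
    (involStep b i (involStep b i k).next).commutes = (involStep b i k).commutes := by
  revert b i k; decide +kernel

theorem ascends_next (b : Bool) (i : Fin 3) (k : Fin 10) :
    (involStep b i (involStep b i k).next).ascends = !(involStep b i k).ascends := by
  revert b i k; decide +kernel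

theorem exists_step_lt (b : Bool) (k : Fin 10) (hk : k ≠ 0) :
    ∃ i j, j < k ∧ (involStep b i j).ascends = true ∧ (involStep b i j).next = k := by
  revert b k; decide +kernel

/-- The diagram automorphisms of `Perm (Fin 4)`. -/
def starPerm (b : Bool) (p : Equiv.Perm (Fin 4)) : Equiv.Perm (Fin 4) :=
  if b then Fin.revPerm * p * Fin.revPerm else p

section InvolutionModule

variable {R M : Type*} [CommRing R] [AddCommGroup M] [Module R M]

/-- The coefficient of `a_w` in `T_s a_w`. -/
def diagCoeff (q : R) (st : InvolStep) : R :=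
  match st.commutes, st.ascends with
  | true, true => q
  | true, false => q ^ 2 - q - 1
  | false, true => 0
  | false, false => q ^ 2 - 1

/-- The coefficient of the other basis element in `T_s a_w`. -/
def offCoeff (q : R) (st : InvolStep) : R :=
  match st.commutes, st.ascends with
  | true, true => q + 1
  | true, false => q ^ 2 - q
  | false, true => 1
  | false, false => q ^ 2

variable {q : R} {a : Module.Basis (Fin 10) R M} {T : Fin 3 → Module.End R M} {b : Bool}
  (hT : ∀ i k, T i (a k) =
    diagCoeff q (involStep b i k) • a k + offCoeff q (involStep b i k) • a (involStep b i k).next)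

include hT

theorem involution_quadratic (i : Fin 3) :
    T i * T i = (q ^ 2 - 1) • T i + q ^ 2 • (1 : Module.End R M) := by
  refine a.ext fun k => ?_
  have h1 := commutes_next b i k
  have h2 := ascends_next b i k
  have h3 := next_next b i k
  simp only [Module.End.mul_apply, LinearMap.add_apply, LinearMap.smul_apply,
    Module.End.one_apply, hT, map_add, map_smul, h3]
  rcases hc : (involStep b i k).commutes <;> rcases ha : (involStep b i k).ascends <;>
    simp [diagCoeff, offCoeff, h1, h2, hc, ha] <;> module

theorem coord_involution_step (i : Fin 3) (k : Fin 10) (v : M) :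
    a.coord k (T i v) = diagCoeff q (involStep b i k) * a.coord k v +
      offCoeff q (involStep b i (involStep b i k).next) * a.coord (involStep b i k).next v := by
  have : a.coord k ∘ₗ T i = diagCoeff q (involStep b i k) • a.coord k +
      offCoeff q (involStep b i (involStep b i k).next) • a.coord (involStep b i k).next := by
    refine a.ext fun j => ?_
    have hjk : (involStep b i j).next = k ↔ j = (involStep b i k).next :=
      ⟨fun h => by rw [← h, next_next], fun h => by rw [h, next_next]⟩
    simp only [LinearMap.comp_apply, hT, map_add, map_smul, LinearMap.add_apply,
      LinearMap.smul_apply, Module.Basis.coord_apply, Module.Basis.repr_self,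
      Finsupp.single_apply, hjk, smul_eq_mul, mul_ite, mul_one, mul_zero]
    congr 1
    · split_ifs with h
      · rw [h]
      · rfl
    · split_ifs with h
      · rw [h]
      · rfl
  exact LinearMap.congr_fun this v

theorem involution_isBraidTriple : IsBraidTriple T := by
  refine ⟨a.ext fun k => ?_, a.ext fun k => ?_, a.ext fun k => ?_⟩ <;>
  cases b <;> fin_cases k <;>
  · simp only [Module.End.mul_apply, hT, map_add, map_smul, involStep, diagCoeff, offCoeff,
      Matrix.cons_val, Fin.isValue, Fin.zero_eta, Fin.mk_one, Fin.reduceFinMk]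
    try module

set_option maxHeartbeats 2000000 in
theorem coord_zero_nfWord (x : NFCode) :
    a.coord 0 (((nfWord x).map T).prod (a 0)) =
      if starPerm b (nfPerm x) = nfPerm x then q ^ (nfWord x).length else 0 := by
  obtain ⟨c₁, c₂, c₃⟩ := x
  cases b <;> fin_cases c₁ <;> fin_cases c₂ <;> fin_cases c₃ <;>
  · first
    | rw [if_pos (by decide +kernel)]
    | rw [if_neg (by decide +kernel)]
    simp only [nfWord, List.take, List.cons_append, List.nil_append, List.append_nil, List.map_cons,
      List.map_nil, List.prod_cons, List.prod_nil, mul_one, Module.End.mul_apply,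
      Module.End.one_apply, Fin.isValue, List.length_cons, List.length_nil]
    simp only [coord_involution_step hT, involStep, diagCoeff, offCoeff, Matrix.cons_val,
      Fin.isValue, Module.Basis.coord_apply, Module.Basis.repr_self, Finsupp.single_apply,
      Fin.reduceEq, if_true, if_false, mul_zero, zero_mul, add_zero, zero_add, one_mul, mul_one]
    try ring

end InvolutionModule

theorem offCoeff_u_ne_zero (st : InvolStep) : offCoeff u st ≠ 0 := by
  have h : u ^ 2 - u ≠ 0 := by
    rw [sq, ← mul_sub_one]; exact mul_ne_zero u_ne_zero u_sub_one_ne_zero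
  obtain ⟨_ | _, _ | _, k⟩ := st
  · exact pow_ne_zero 2 u_ne_zero
  · exact one_ne_zero
  · exact h
  · exact u_add_one_ne_zero

theorem rho_apply (cs : CoxeterSystem Mat W) (i : B) (v : W →₀ K) (x : W) :
    rho cs (cs.simple i) v x =
      if cs.length (cs.simple i * x) > cs.length x then u ^ 2 * v (cs.simple i * x)
      else v (cs.simple i * x) + (u ^ 2 - 1) * v x := by
  classical
  induction v using Finsupp.induction_linear with
  | zero => simp
  | add f g hf hg => rw [map_add, Finsupp.add_apply, hf, hg]; split_ifs <;> simp <;> ring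
  | single y c =>
    have hne : cs.simple i * y ≠ y := fun h => cs.length_simple_mul_ne y i (by rw [h])
    simp only [rho, Finsupp.lsum_single, LinearMap.toSpanSingleton_apply]
    by_cases h1 : y = x
    · subst h1
      split_ifs <;> simp [hne, hne.symm, mul_comm]
    · by_cases h2 : y = cs.simple i * x
      · subst h2
        have hl := cs.length_simple_mul_ne x i
        split_ifs <;> simp_all [cs.simple_mul_simple_cancel_left, mul_comm] <;> omega
      · have h3 : cs.simple i * y ≠ x := fun h => h2 (by rw [← h, cs.simple_mul_simple_cancel_left])
        split_ifs <;> simp [h1, h2, h3]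

theorem Xempty_apply [Fintype W] [DecidableEq W] (cs : CoxeterSystem Mat W) (star : W ≃* W)
    (x : W) : Xempty cs star x = if star x = x then u ^ (-(cs.length x : ℤ)) else 0 := by
  rw [Xempty, Finsupp.finsetSum_apply, Finset.sum_eq_single x]
  · split_ifs <;> simp
  · intro y _ hy
    split_ifs <;> simp [hy]
  · simp

/-- The existence and uniqueness of `η` follow from an injective equivariant map `φ : M → V`
with `φ a_e = X_∅`, when `a_e` generates `M`. -/
theorem existsUnique_isEta [Fintype W] [DecidableEq W] (cs : CoxeterSystem Mat W) (star : W ≃* W)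
    (Ts : B → InvolM star →ₗ[K] InvolM star) (φ : InvolM star →ₗ[K] (W →₀ K))
    (hinj : Function.Injective φ)
    (hφ : φ (single ⟨1, one_mem_Istar star⟩ 1) = Xempty cs star)
    (hρ : ∀ i m, rho cs (cs.simple i) (φ m) = φ (Ts i m))
    (hgen : ∀ p : Submodule K (InvolM star), single ⟨1, one_mem_Istar star⟩ 1 ∈ p →
      (∀ i, ∀ m ∈ p, Ts i m ∈ p) → p = ⊤) :
    ∃! η : ↥(MM cs star) →ₗ[K] InvolM star, IsEta cs star Ts η := by
  have hle : MM cs star ≤ LinearMap.range φ := by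
    refine sInf_le ⟨⟨_, hφ⟩, ?_⟩
    rintro i _ ⟨m, rfl⟩
    exact ⟨Ts i m, (hρ i m).symm⟩
  have hmem (m) : φ m ∈ MM cs star := by
    have : (MM cs star).comap φ = ⊤ := by
      refine hgen _ ?_ fun i m hm => ?_
      · rw [Submodule.mem_comap, hφ]; exact Xempty_mem_MM cs star
      · rw [Submodule.mem_comap, ← hρ]; exact rho_mem_MM cs star i _ hm
    exact (this ▸ Submodule.mem_top : m ∈ (MM cs star).comap φ)
  let ψ : InvolM star ≃ₗ[K] ↥(MM cs star) := LinearEquiv.ofBijective (φ.codRestrict _ hmem)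
    ⟨fun m n h => hinj (congrArg Subtype.val h), fun v => by
      obtain ⟨m, hm⟩ := hle v.2
      exact ⟨m, Subtype.ext hm⟩⟩
  have hψ (m) : (ψ m : W →₀ K) = φ m := rfl
  refine ⟨ψ.symm, ⟨ψ.symm.bijective, ?_, fun i v => ?_⟩, ?_⟩
  · exact ψ.symm_apply_eq.2 (Subtype.ext hφ.symm)
  · obtain ⟨m, rfl⟩ := ψ.surjective v
    refine ψ.symm_apply_eq.2 (Subtype.ext ?_)
    simp only [hψ, LinearEquiv.coe_coe, LinearEquiv.symm_apply_apply, hρ]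
  · rintro η ⟨-, h1, h2⟩
    have key : LinearMap.eqLocus (η ∘ₗ ψ.toLinearMap) LinearMap.id = ⊤ := by
      have hone : ψ (single ⟨1, one_mem_Istar star⟩ 1) =
          ⟨Xempty cs star, Xempty_mem_MM cs star⟩ := Subtype.ext hφ
      refine hgen _ ?_ fun i m hm => ?_
      · rw [LinearMap.mem_eqLocus, LinearMap.comp_apply, LinearEquiv.coe_coe, hone, h1]
        rfl
      · rw [LinearMap.mem_eqLocus, LinearMap.comp_apply, LinearEquiv.coe_coe,
          LinearMap.id_apply] at hm ⊢
        have : ψ (Ts i m) = ⟨rho cs (cs.simple i) (ψ m : W →₀ K),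
            rho_mem_MM cs star i _ (ψ m).2⟩ := Subtype.ext (hρ i m).symm
        rw [this, h2, hm]
    refine LinearMap.ext fun v => ?_
    obtain ⟨m, rfl⟩ := ψ.surjective v
    have : m ∈ LinearMap.eqLocus (η ∘ₗ ψ.toLinearMap) LinearMap.id := key ▸ Submodule.mem_top
    simpa using this

/-- The twisted involutions of `Perm (Fin 4)`. -/
def involPerm (b : Bool) (k : Fin 10) : Equiv.Perm (Fin 4) := ((involWord b k).map adjSwap).prod

theorem involPerm_injective (b : Bool) : Function.Injective (involPerm b) := by
  intro k l; revert b k l; decide +kernel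

theorem starPerm_involPerm (b : Bool) (k : Fin 10) :
    starPerm b (involPerm b k) = (involPerm b k)⁻¹ := by
  revert b k; decide +kernel

theorem exists_involPerm (b : Bool) (p : Equiv.Perm (Fin 4)) (hp : starPerm b p = p⁻¹) :
    ∃ k, involPerm b k = p := by
  obtain ⟨x, rfl⟩ := nfPerm_bijective.2 p
  revert b x; decide +kernel

theorem involPerm_next_of_commutes (b : Bool) (i : Fin 3) (k : Fin 10)
    (h : (involStep b i k).commutes = true) :
    involPerm b (involStep b i k).next = adjSwap i * involPerm b k ∧
      adjSwap i * involPerm b k = involPerm b k * starPerm b (adjSwap i) := by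
  revert b i k; decide +kernel

theorem involPerm_next_of_not_commutes (b : Bool) (i : Fin 3) (k : Fin 10)
    (h : (involStep b i k).commutes = false) :
    involPerm b (involStep b i k).next = adjSwap i * involPerm b k * starPerm b (adjSwap i) ∧
      adjSwap i * involPerm b k ≠ involPerm b k * starPerm b (adjSwap i) := by
  revert b i k; decide +kernel

theorem invCount_of_ascends (b : Bool) (i : Fin 3) (k : Fin 10)
    (h : (involStep b i k).ascends = true) :
    invCount (involPerm b k) < invCount (adjSwap i * involPerm b k) := by
  revert b i k; decide +kernel

theorem invCount_of_not_ascends (b : Bool) (i : Fin 3) (k : Fin 10)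
    (h : (involStep b i k).ascends = false) :
    invCount (adjSwap i * involPerm b k) < invCount (involPerm b k) := by
  revert b i k; decide +kernel

theorem diagram_automorphism (σ : Fin 3 → Fin 3) (hσ : ∀ i, σ (σ i) = i)
    (hlift : (CoxeterMatrix.Aₙ 3).IsLiftable (adjSwap ∘ σ)) :
    ∃ b, ∀ i, adjSwap (σ i) = starPerm b (adjSwap i) := by
  rw [isLiftable_iff_A3] at hlift
  revert σ; decide +kernel

/-- `starPerm` as a group homomorphism. -/
def starPermHom (b : Bool) : Equiv.Perm (Fin 4) →* Equiv.Perm (Fin 4) where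
  toFun := starPerm b
  map_one' := by revert b; decide +kernel
  map_mul' p q := by
    cases b
    · rfl
    · ext x; simp [starPerm]

theorem exists_toPerm_star {W : Type*} [Group W] (cs : CoxeterSystem (CoxeterMatrix.Aₙ 3) W)
    (star : W ≃* W) (hstar2 : ∀ w : W, star (star w) = w)
    (hstarS : ∀ i : Fin 3, ∃ j : Fin 3, star (cs.simple i) = cs.simple j) :
    ∃ b, ∀ w, toPerm cs (star w) = starPerm b (toPerm cs w) := by
  choose σ hσ using hstarS
  have hinj : Function.Injective adjSwap := by
    intro i j; revert i j; decide +kernel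
  have hσσ (i) : σ (σ i) = i := by
    have h := hstar2 (cs.simple i)
    rw [hσ, hσ] at h
    have h' := congrArg (toPerm cs) h
    rw [toPerm_simple, toPerm_simple] at h'
    exact hinj h'
  have hf : adjSwap ∘ σ = fun i => toPerm cs (star (cs.simple i)) := by
    funext i; rw [hσ, toPerm_simple, Function.comp_apply]
  obtain ⟨b, hb⟩ := diagram_automorphism σ hσσ <| by
    intro i j
    rw [hf, ← map_mul, ← map_mul, ← map_pow, ← map_pow, cs.simple_mul_simple_pow, map_one,
      map_one]
  refine ⟨b, fun w => ?_⟩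
  have : (toPerm cs).comp star.toMonoidHom = (starPermHom b).comp (toPerm cs) := by
    refine cs.ext_simple fun i => ?_
    simp only [MonoidHom.comp_apply, toPerm_simple]
    exact (congrFun hf i).symm.trans (hb i)
  exact DFunLike.congr_fun this w

section HeckeAction

variable {W : Type*} [Group W] (cs : CoxeterSystem (CoxeterMatrix.Aₙ 3) W)

/-- The code of the normal form of an element. -/
def nfCode (w : W) : NFCode := (Equiv.ofBijective _ nfPerm_bijective).symm (toPerm cs w)

theorem nfPerm_nfCode (w : W) : nfPerm (nfCode cs w) = toPerm cs w :=
  (Equiv.ofBijective _ nfPerm_bijective).apply_symm_apply _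

theorem length_nfWord_nfCode (w : W) : (nfWord (nfCode cs w)).length = cs.length w := by
  rw [length_eq_invCount, ← nfPerm_nfCode, invCount_nfPerm]

theorem nfCode_mul_simple (w : W) (i : Fin 3) :
    nfCode cs (w * cs.simple i) = nfMul (nfCode cs w) i :=
  nfPerm_injective <| by
    rw [nfPerm_nfCode, nfPerm_nfMul, nfPerm_nfCode, map_mul, toPerm_simple]

/-- The product of the `t i` along a reduced word of `w`. -/
def reducedProd {N : Type*} [Monoid N] (t : Fin 3 → N) (w : W) : N :=
  ((nfWord (nfCode cs w)).map t).prod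

theorem reducedProd_mul_simple {N : Type*} [Monoid N] {t : Fin 3 → N} (ht : IsBraidTriple t)
    (w : W) (i : Fin 3) (h : cs.length w < cs.length (w * cs.simple i)) :
    reducedProd cs t (w * cs.simple i) = reducedProd cs t w * t i := by
  rw [← length_nfWord_nfCode, ← length_nfWord_nfCode, nfCode_mul_simple] at h
  rw [reducedProd, nfCode_mul_simple]
  exact prod_nfWord_nfMul_of_lt ht _ i h

variable [Finite W] {M : Type*} [AddCommGroup M] [Module K M]

/-- The map `M → V` sending `m` to `∑ x, u^{-2l(x)} ε(T_{x⁻¹} m) δ_x`. -/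
def heckeEmbedding (T : Fin 3 → Module.End K M) (ε : M →ₗ[K] K) : M →ₗ[K] (W →₀ K) :=
  (Finsupp.linearEquivFunOnFinite K K W).symm.toLinearMap ∘ₗ
    LinearMap.pi fun x => (u⁻¹ ^ (2 * cs.length x)) • (ε ∘ₗ reducedProd cs T x⁻¹)

theorem heckeEmbedding_apply (T : Fin 3 → Module.End K M) (ε : M →ₗ[K] K) (m : M) (x : W) :
    heckeEmbedding cs T ε m x = u⁻¹ ^ (2 * cs.length x) * ε (reducedProd cs T x⁻¹ m) := rfl

theorem rho_heckeEmbedding {T : Fin 3 → Module.End K M} (hT : IsBraidTriple T)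
    (hquad : ∀ i, T i * T i = (u ^ 2 - 1) • T i + u ^ 2 • (1 : Module.End K M))
    (ε : M →ₗ[K] K) (i : Fin 3) (m : M) :
    rho cs (cs.simple i) (heckeEmbedding cs T ε m) = heckeEmbedding cs T ε (T i m) := by
  have hu : u ^ 2 * u⁻¹ ^ 2 = 1 := by
    rw [← mul_pow, mul_inv_cancel₀ u_ne_zero, one_pow]
  have hexp (n : ℕ) : u⁻¹ ^ (2 * (n + 1)) = u⁻¹ ^ (2 * n) * u⁻¹ ^ 2 := by
    rw [mul_add, mul_one, pow_add]
  ext x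
  have hinv : x⁻¹ * cs.simple i = (cs.simple i * x)⁻¹ := by rw [mul_inv_rev, cs.inv_simple]
  rw [rho_apply]
  simp only [heckeEmbedding_apply]
  rcases cs.length_simple_mul x i with h | h
  · rw [if_pos (by omega), ← hinv, reducedProd_mul_simple cs hT _ _
      (by rw [hinv, cs.length_inv, cs.length_inv]; omega), h, Module.End.mul_apply, hexp]
    linear_combination
      u⁻¹ ^ (2 * cs.length x) * ε (reducedProd cs T x⁻¹ (T i m)) * hu
  · have hx : x⁻¹ = (cs.simple i * x)⁻¹ * cs.simple i := by
      rw [← hinv, cs.simple_mul_simple_cancel_right]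
    have hr : reducedProd cs T x⁻¹ = reducedProd cs T (cs.simple i * x)⁻¹ * T i := by
      conv_lhs => rw [hx]
      refine reducedProd_mul_simple cs hT _ _ ?_
      rw [← hx, cs.length_inv, cs.length_inv]; omega
    have hq : T i (T i m) = (u ^ 2 - 1) • T i m + u ^ 2 • m :=
      LinearMap.congr_fun (hquad i) m
    rw [if_neg (by omega), hr, ← h, Module.End.mul_apply, Module.End.mul_apply, hq, hexp]
    simp only [map_add, map_smul, smul_eq_mul]
    linear_combination
      -(u⁻¹ ^ (2 * cs.length (cs.simple i * x)) *
        ε (reducedProd cs T (cs.simple i * x)⁻¹ m)) * hu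

end HeckeAction

section InvolutionBasis

variable {W : Type*} [Group W] (cs : CoxeterSystem (CoxeterMatrix.Aₙ 3) W) {star : W ≃* W}
  {b : Bool} (hb : ∀ w, toPerm cs (star w) = starPerm b (toPerm cs w))

include hb

theorem wordProd_involWord_mem (k : Fin 10) : cs.wordProd (involWord b k) ∈ Istar star := by
  refine (toPerm_bijective cs).1 ?_
  rw [hb, map_inv, toPerm_wordProd]
  exact starPerm_involPerm b k

/-- The enumeration of the twisted involutions. -/
def involEquiv : Fin 10 ≃ ↥(Istar star) :=
  Equiv.ofBijective (fun k => ⟨cs.wordProd (involWord b k), wordProd_involWord_mem cs hb k⟩) <| by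
    constructor
    · intro k l h
      have := congrArg (toPerm cs) (congrArg Subtype.val h)
      simp only [toPerm_wordProd] at this
      exact involPerm_injective b this
    · rintro ⟨w, hw⟩
      have hw' : starPerm b (toPerm cs w) = (toPerm cs w)⁻¹ := by
        rw [← hb, ← map_inv, show star w = w⁻¹ from hw]
      obtain ⟨k, hk⟩ := exists_involPerm b _ hw'
      refine ⟨k, Subtype.ext ((toPerm_bijective cs).1 ?_)⟩
      rw [toPerm_wordProd, ← hk]
      rfl

theorem toPerm_involEquiv (k : Fin 10) :
    toPerm cs (involEquiv cs hb k : W) = involPerm b k := toPerm_wordProd cs _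

theorem involEquiv_zero : involEquiv cs hb 0 = ⟨1, one_mem_Istar star⟩ :=
  Subtype.ext <| (toPerm_bijective cs).1 <| by
    rw [toPerm_involEquiv, map_one]
    cases b <;> rfl

/-- The basis `a_w` of `M`, indexed by `Fin 10`. -/
def involBasis : Module.Basis (Fin 10) K (InvolM star) :=
  Finsupp.basisSingleOne.reindex (involEquiv cs hb).symm

theorem involBasis_apply (k : Fin 10) : involBasis cs hb k = single (involEquiv cs hb k) 1 := by
  simp [involBasis]

theorem IsTs.apply_involBasis {i : Fin 3} {T : InvolM star →ₗ[K] InvolM star}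
    (hT : IsTs cs star i T) (k : Fin 10) :
    T (involBasis cs hb k) = diagCoeff u (involStep b i k) • involBasis cs hb k +
      offCoeff u (involStep b i k) • involBasis cs hb (involStep b i k).next := by
  have hinj := (toPerm_bijective cs).1
  have hup (h : (involStep b i k).ascends = true) :
      cs.length (cs.simple i * (involEquiv cs hb k : W)) >
        cs.length (involEquiv cs hb k : W) := by
    rw [length_eq_invCount, length_eq_invCount, map_mul, toPerm_simple, toPerm_involEquiv]
    exact invCount_of_ascends b i k h
  have hdown (h : (involStep b i k).ascends = false) :
      cs.length (cs.simple i * (involEquiv cs hb k : W)) <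
        cs.length (involEquiv cs hb k : W) := by
    rw [length_eq_invCount, length_eq_invCount, map_mul, toPerm_simple, toPerm_involEquiv]
    exact invCount_of_not_ascends b i k h
  simp only [involBasis_apply]
  rcases hc : (involStep b i k).commutes
  · obtain ⟨h1, h2⟩ := involPerm_next_of_not_commutes b i k hc
    have h := (hT (involEquiv cs hb k)).2 (involEquiv cs hb (involStep b i k).next)
      (hinj (by simpa only [map_mul, toPerm_simple, toPerm_involEquiv, hb] using h1))
      (fun he => h2 (by
        simpa only [map_mul, toPerm_simple, toPerm_involEquiv, hb] using congrArg (toPerm cs) he))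
    rcases ha : (involStep b i k).ascends
    · simpa only [diagCoeff, offCoeff, hc, ha] using h.2 (hdown ha)
    · simpa only [diagCoeff, offCoeff, hc, ha, zero_smul, one_smul, zero_add] using h.1 (hup ha)
  · obtain ⟨h1, h2⟩ := involPerm_next_of_commutes b i k hc
    have h := (hT (involEquiv cs hb k)).1 (involEquiv cs hb (involStep b i k).next)
      (hinj (by simpa only [map_mul, toPerm_simple, toPerm_involEquiv, hb] using h1))
      (hinj (by simpa only [map_mul, toPerm_simple, toPerm_involEquiv, hb] using h2))
    rcases ha : (involStep b i k).ascends
    · simpa only [diagCoeff, offCoeff, hc, ha] using h.2 (hdown ha)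
    · simpa only [diagCoeff, offCoeff, hc, ha] using h.1 (hup ha)

end InvolutionBasis

section Generation

variable {M : Type*} [AddCommGroup M] [Module K M] {a : Module.Basis (Fin 10) K M}
  {T : Fin 3 → Module.End K M} {b : Bool}
  (hT : ∀ i k, T i (a k) =
    diagCoeff u (involStep b i k) • a k + offCoeff u (involStep b i k) • a (involStep b i k).next)

include hT

theorem eq_top_of_basis_zero_mem (p : Submodule K M) (h0 : a 0 ∈ p)
    (hp : ∀ i, ∀ m ∈ p, T i m ∈ p) : p = ⊤ := by
  have hmem (k : Fin 10) : a k ∈ p := by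
    induction k using WellFoundedLT.induction with
    | ind k ih =>
      by_cases hk : k = 0
      · rwa [hk]
      obtain ⟨i, j, hj, -, rfl⟩ := exists_step_lt b k hk
      have h1 := hp i _ (ih j hj)
      rw [hT, p.add_mem_iff_right (p.smul_mem _ (ih j hj)),
        p.smul_mem_iff (offCoeff_u_ne_zero _)] at h1
      exact h1
  rw [eq_top_iff, ← a.span_eq, Submodule.span_le]
  rintro _ ⟨k, rfl⟩
  exact hmem k

theorem eq_bot_of_le_ker_coord_zero (p : Submodule K M) (h0 : ∀ m ∈ p, a.coord 0 m = 0)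
    (hp : ∀ i, ∀ m ∈ p, T i m ∈ p) : p = ⊥ := by
  have hzero (k : Fin 10) : ∀ m ∈ p, a.coord k m = 0 := by
    induction k using WellFoundedLT.induction with
    | ind k ih =>
      by_cases hk : k = 0
      · rwa [hk]
      obtain ⟨i, j, hj, -, rfl⟩ := exists_step_lt b k hk
      intro m hm
      have h1 := ih j hj _ (hp i m hm)
      rw [coord_involution_step hT, ih j hj m hm, mul_zero, zero_add] at h1
      exact (mul_eq_zero.1 h1).resolve_left (offCoeff_u_ne_zero _)
  rw [eq_bot_iff]
  intro m hm
  exact (Submodule.mem_bot K).2 (a.forall_coord_eq_zero_iff.1 fun k => hzero k m hm)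

end Generation

/-- for the Coxeter system of type `A₃` (matrix `CoxeterMatrix.Aₙ 3`, so
`S = {s₁, s₂, s₃}` with `sᵢ² = e`, `(s₁s₂)³ = (s₂s₃)³ = e`, `(s₁s₃)² = e`) and any group
automorphism `*` of `W` with `S* = S` and `*∘* = id`, there exists a unique `K`-linear
bijection `η : 𝕄 → M` such that `η(X_∅) = a_e` and `η(ρ_s(v)) = T_s(η(v))` for all
`s ∈ S` and `v ∈ 𝕄`. -/
theorem statement10 {W : Type*} [Group W] [Fintype W] [DecidableEq W]
    (cs : CoxeterSystem (CoxeterMatrix.Aₙ 3) W) (star : W ≃* W)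
    (hstar2 : ∀ w : W, star (star w) = w)
    (hstarS : ∀ i : Fin 3, ∃ j : Fin 3, star (cs.simple i) = cs.simple j)
    (Ts : Fin 3 → InvolM star →ₗ[K] InvolM star)
    (hTs : ∀ i, IsTs cs star i (Ts i)) :
    ∃! η : ↥(MM cs star) →ₗ[K] InvolM star, IsEta cs star Ts η := by
  obtain ⟨b, hb⟩ := exists_toPerm_star cs star hstar2 hstarS
  set a := involBasis cs hb with ha
  have hT (i k) := (hTs i).apply_involBasis cs hb k
  have ha0 : a 0 = single ⟨1, one_mem_Istar star⟩ 1 := by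
    rw [ha, involBasis_apply, involEquiv_zero]
  have hbraid : IsBraidTriple (N := Module.End K (InvolM star)) Ts := involution_isBraidTriple hT
  have hρ (i m) := rho_heckeEmbedding cs hbraid (involution_quadratic hT) (a.coord 0) i m
  refine existsUnique_isEta cs star Ts (heckeEmbedding cs Ts (a.coord 0)) ?_ ?_ hρ ?_
  · refine LinearMap.ker_eq_bot.1 (eq_bot_of_le_ker_coord_zero hT _ (fun m hm => ?_)
      fun i m hm => ?_)
    · have h := DFunLike.congr_fun (LinearMap.mem_ker.1 hm) (1 : W)
      have hc : nfCode cs (1 : W) = (0, 0, 0) := nfPerm_injective (by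
        rw [nfPerm_nfCode, map_one]; rfl)
      simpa [heckeEmbedding_apply, reducedProd, hc, nfWord] using h
    · rw [LinearMap.mem_ker] at hm ⊢
      rw [← hρ, hm, map_zero]
  · rw [← ha0]
    ext x
    have hfix : starPerm b (toPerm cs x⁻¹) = toPerm cs x⁻¹ ↔ star x = x := by
      rw [← hb, (toPerm_bijective cs).1.eq_iff, map_inv, inv_inj]
    rw [heckeEmbedding_apply, Xempty_apply, reducedProd, coord_zero_nfWord hT, nfPerm_nfCode,
      length_nfWord_nfCode, cs.length_inv]
    simp only [hfix]
    split_ifs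
    · have hu := u_ne_zero
      rw [zpow_neg, zpow_natCast, two_mul, pow_add, inv_pow]
      field_simp
    · rw [mul_zero]
  · intro p hp
    rw [← ha0] at hp
    exact eq_top_of_basis_zero_mem hT p hp

end
end
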